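/- Let K be a field admitting a cyclic Galois extension of odd degree n = 2m+1 and let Alt_n(K) denote the K-vector space of all n × n skew-symmetric matrices over K (matrices A with Aᵀ = −A and zero diagonal). Then there exist m subspaces S^1, …, S^m of Alt_n(K), each of K-dimension n, such that Alt_n(K) = S^1 ⊕ ⋯ ⊕ S^m, the nonzero elements of each S^i have constant rank, and for each integer k with 1 ≤ k ≤ m, every nonzero element of the nk-dimensional subspace S^1 ⊕ ⋯ ⊕ S^k has matrix rank at least n − 2k + 1. -/

import Mathlib

/-- The space `Alt_n(K)` of `n × n` alternating (skew-symmetric with zero diagonal)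
matrices over `K`. -/
def altMatrixSubspace (K : Type*) [Field K] (n : ℕ) :
    Submodule K (Matrix (Fin n) (Fin n) K) where
  carrier := {A | A.transpose = -A ∧ ∀ i, A i i = 0}
  add_mem' := fun {A B} hA hB =>
    ⟨by rw [Matrix.transpose_add, hA.1, hB.1, neg_add], fun i => by
      simp [hA.2 i, hB.2 i]⟩
  zero_mem' := ⟨by simp, fun i => rfl⟩
  smul_mem' := fun a {A} hA =>
    ⟨by rw [Matrix.transpose_smul, hA.1, smul_neg], fun i => by simp [hA.2 i]⟩

section Aux
open Module

theorem aux_alt_even {K V : Type*} [Field K] [AddCommGroup V] [Module K V] [FiniteDimensional K V]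
    (B : LinearMap.BilinForm K V) (hB : B.IsAlt) :
    Even (finrank K V + finrank K (LinearMap.ker B)) := by
  obtain ⟨M, -, hM⟩ := exists_maximal_ge_of_wellFoundedGT
    (fun W : Submodule K V => W ≤ B.orthogonal W) (⊥ : Submodule K V) bot_le
  have hEq : B.orthogonal M = M := by
    refine le_antisymm (fun x hx => ?_) hM.1
    have h2 : M ⊔ K ∙ x ≤ B.orthogonal (M ⊔ K ∙ x) := by
      intro u hu
      rw [LinearMap.BilinForm.mem_orthogonal_iff]
      intro w hw
      obtain ⟨a, ha, b, hb, rfl⟩ := Submodule.mem_sup.1 hu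
      obtain ⟨c, hc, d, hd, rfl⟩ := Submodule.mem_sup.1 hw
      obtain ⟨s, rfl⟩ := Submodule.mem_span_singleton.1 hb
      obtain ⟨t, rfl⟩ := Submodule.mem_span_singleton.1 hd
      have h1 : B c a = 0 := hM.1 ha c hc
      have h2 : B c x = 0 := hx c hc
      have h3 : B x a = 0 := (LinearMap.BilinForm.IsAlt.eq_iff hB).1 (hx a ha)
      have h4 : B x x = 0 := hB x
      simp [h1, h2, h3, h4]
    have h3 := hM.2 h2 le_sup_left
    exact h3 (Submodule.mem_sup_right (Submodule.mem_span_singleton_self x))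
  have h := LinearMap.BilinForm.finrank_add_finrank_orthogonal' (B := B) M
  have hk : LinearMap.ker B ≤ M := by
    intro x hx
    rw [← hEq, LinearMap.BilinForm.mem_orthogonal_iff]
    intro y _
    refine (LinearMap.BilinForm.IsAlt.eq_iff hB).1 ?_
    rw [LinearMap.mem_ker.1 hx]; rfl
  rw [hEq, inf_eq_right.2 hk] at h
  exact ⟨_, h.symm⟩

theorem aux_rank {K V : Type*} [Field K] [AddCommGroup V] [Module K V] [FiniteDimensional K V]
    {n : ℕ} (v : Basis (Fin n) K V) (B : LinearMap.BilinForm K V) :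
    (LinearMap.BilinForm.toMatrix v B).rank + finrank K (LinearMap.ker B) = n := by
  have h : (LinearMap.BilinForm.toMatrix v B).transpose = LinearMap.toMatrix v v.dualBasis B := by
    ext i j
    simp [LinearMap.toMatrix_apply, LinearMap.BilinForm.toMatrix_apply]
  rw [← Matrix.rank_transpose, h, Matrix.rank_eq_finrank_range_toLin _ v.dualBasis v,
    Matrix.toLin_toMatrix, LinearMap.finrank_range_add_finrank_ker, finrank_eq_card_basis v]
  simp

theorem aux_sigma {K L : Type*} [Field K] [Field L] [Algebra K L] [FiniteDimensional K L]
    (σ : L ≃ₐ[K] L) (hσ : ∀ x, σ x = x → ∃ a : K, algebraMap K L a = x) (d : ℕ) :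
    ∀ (c : ℕ → L) (V : Submodule K L), d ≤ finrank K V →
      (∀ x ∈ V, ∑ j ∈ Finset.range d, c j * (σ ^ j) x = 0) → ∀ j < d, c j = 0 := by
  induction d with
  | zero => intro c V _ _ j hj; omega
  | succ d ih =>
    intro c V hd hV
    have hne : V ≠ ⊥ := by rintro rfl; simp at hd
    obtain ⟨y, hy, hy0⟩ := Submodule.exists_mem_ne_zero_of_ne_bot hne
    let E : ℕ → L := fun j => ∑ i ∈ Finset.range j, c i * (σ ^ i) y
    have hE0 : E 0 = 0 := by simp [E]
    have hEd : E (d+1) = 0 := hV y hy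
    have hEs : ∀ j, E (j+1) = E j + c j * (σ ^ j) y := fun j => Finset.sum_range_succ _ _
    let g : L →ₗ[K] L := (σ.toLinearMap - LinearMap.id).comp (LinearMap.mulLeft K y⁻¹)
    have hg : ∀ x, g x = σ (y⁻¹ * x) - y⁻¹ * x := fun x => rfl
    have hker : LinearMap.ker g ≤ K ∙ y := by
      intro x hx
      have h1 : σ (y⁻¹ * x) = y⁻¹ * x := by
        rw [← sub_eq_zero, ← hg]; exact hx
      obtain ⟨a, ha⟩ := hσ _ h1
      refine Submodule.mem_span_singleton.2 ⟨a, ?_⟩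
      rw [Algebra.smul_def, ha]; field_simp
    have hk1 : finrank K (LinearMap.ker g) ≤ 1 :=
      (Submodule.finrank_mono hker).trans (finrank_span_singleton hy0).le
    have hVg : d ≤ finrank K (V.map g) := by
      have h1 := LinearMap.finrank_range_add_finrank_ker (g.domRestrict V)
      have h2 : finrank K (LinearMap.ker (g.domRestrict V)) ≤ finrank K (LinearMap.ker g) := by
        rw [← Submodule.finrank_map_subtype_eq V]
        apply Submodule.finrank_mono
        rintro _ ⟨x, hx, rfl⟩
        exact hx
      rw [LinearMap.range_domRestrict] at h1
      omega
    have key := ih (fun j => E (j+1)) (V.map g) hVg (by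
      rintro _ ⟨x, hx, rfl⟩
      have abel : ∀ e : ℕ, ∑ j ∈ Finset.range (e+1), c j * (σ ^ j) x
          = E (e+1) * (σ ^ e) (y⁻¹ * x) - ∑ j ∈ Finset.range e, E (j+1) * (σ ^ j) (g x) := by
        have hx' : ∀ j : ℕ, (σ ^ j) x = (σ ^ j) y * (σ ^ j) (y⁻¹ * x) := by
          intro j; rw [← map_mul]; congr 1; field_simp
        intro e
        induction e with
        | zero => simp [hEs, hE0]; field_simp
        | succ e ihe =>
          rw [Finset.sum_range_succ, ihe, Finset.sum_range_succ _ e, hEs (e+1), hg, map_sub,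
            hx' (e+1)]
          have : (σ ^ e) (σ (y⁻¹ * x)) = (σ ^ (e+1)) (y⁻¹ * x) := by
            rw [pow_succ]; rfl
          rw [this]; ring
      have h := abel d
      rw [hV x hx, hEd, zero_mul, zero_sub, eq_comm, neg_eq_zero] at h
      exact h)
    have hEall : ∀ j ≤ d + 1, E j = 0 := by
      intro j hj
      rcases j with _ | j
      · exact hE0
      · rcases Nat.lt_or_ge j d with h | h
        · exact key j h
        · have : j = d := by omega
          subst this; exact hEd
    intro j hj
    have h := hEs j
    rw [hEall j (by omega), hEall (j+1) (by omega), zero_add] at h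
    have h3 : (σ ^ j) y ≠ 0 := fun h0 => hy0 ((map_eq_zero_iff _ (σ ^ j).injective).1 h0)
    exact (mul_eq_zero.1 h.symm).resolve_right h3

/-- basic form -/
noncomputable def form1 {K L : Type*} [Field K] [Field L] [Algebra K L] (τ : L ≃ₐ[K] L) (b : L) :
    LinearMap.BilinForm K L :=
  LinearMap.mk₂ K (fun x y => Algebra.trace K L (b * (x * τ y - τ x * y)))
    (by intros; rw [← map_add]; congr 1; rw [map_add]; ring)
    (by intros; rw [← map_smul]; congr 1; rw [map_smul]; simp only [Algebra.smul_def]; ring)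
    (by intros; rw [← map_add]; congr 1; rw [map_add]; ring)
    (by intros; rw [← map_smul]; congr 1; rw [map_smul]; simp only [Algebra.smul_def]; ring)

theorem form1_apply {K L : Type*} [Field K] [Field L] [Algebra K L] (τ : L ≃ₐ[K] L) (b x y : L) :
    form1 τ b x y = Algebra.trace K L (b * (x * τ y - τ x * y)) := rfl

theorem trace_pow {K L : Type*} [Field K] [Field L] [Algebra K L] (τ : L ≃ₐ[K] L) (x : L) :
    Algebra.trace K L (τ x) = Algebra.trace K L x := by
  simpa using Algebra.trace_eq_of_algEquiv τ x

theorem aux_nondeg {K L : Type*} [Field K] [Field L] [Algebra K L] [FiniteDimensional K L]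
    [Algebra.IsSeparable K L] (w : L) (h : ∀ x, Algebra.trace K L (x * w) = 0) : w = 0 := by
  refine (traceForm_nondegenerate K L).2 w ?_
  intro x; exact h x

theorem form1_ker {K L : Type*} [Field K] [Field L] [Algebra K L] [FiniteDimensional K L]
    [Algebra.IsSeparable K L] (τ : L ≃ₐ[K] L) (b y : L) :
    y ∈ LinearMap.ker (form1 τ b) ↔ τ b * τ (τ y) = b * y := by
  have h : ∀ x, form1 τ b y x = Algebra.trace K L (τ x * (b * y - τ b * τ (τ y))) := by
    intro x
    rw [form1_apply, mul_sub, map_sub, ← trace_pow τ (b * (τ y * x)), ← map_sub]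
    congr 1; simp only [map_mul]; ring
  rw [LinearMap.mem_ker]
  constructor
  · intro hy
    refine (sub_eq_zero.1 (aux_nondeg (K := K) _ fun x => ?_)).symm
    obtain ⟨x, rfl⟩ := τ.surjective x
    rw [← h, hy]; rfl
  · intro hy
    ext x
    rw [h, hy]; simp

theorem form1_alt {K L : Type*} [Field K] [Field L] [Algebra K L] (τ : L ≃ₐ[K] L) (b : L) :
    (form1 τ b).IsAlt := by
  intro x
  rw [form1_apply]; simp [mul_comm]

theorem form1_rank {K L : Type*} [Field K] [Field L] [Algebra K L] [FiniteDimensional K L]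
    [Algebra.IsSeparable K L] (τ : L ≃ₐ[K] L) (m : ℕ) (hn : finrank K L = 2 * m + 1)
    (hτ : τ ^ (2 * m + 1) = 1) (b : L) (hb : b ≠ 0) :
    finrank K (LinearMap.ker (form1 τ b)) =
      finrank K (LinearMap.ker (τ.toLinearMap - LinearMap.id)) := by
  have hev := aux_alt_even _ (form1_alt τ b)
  have hne : LinearMap.ker (form1 τ b) ≠ ⊥ := by
    intro h
    rw [h, hn, finrank_bot] at hev
    exact (Nat.not_even_iff_odd.2 ⟨m, rfl⟩) hev
  obtain ⟨y, hy, hy0⟩ := Submodule.exists_mem_ne_zero_of_ne_bot hne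
  have hy' := (form1_ker τ b y).1 hy
  have : LinearMap.ker (form1 τ b) =
      (LinearMap.ker (τ.toLinearMap - LinearMap.id)).map (LinearMap.mulLeft K y) := by
    ext x
    constructor
    · intro hx
      refine ⟨y⁻¹ * x, ?_, by simp; field_simp⟩
      have hx' := (form1_ker τ b x).1 hx
      set u := y⁻¹ * x with hu
      have hxu : x = y * u := by rw [hu]; field_simp
      have h2 : τ (τ u) = u := by
        rw [hxu, map_mul, map_mul, ← mul_assoc, hy', mul_assoc, mul_right_inj' hb,
          mul_right_inj' hy0] at hx'
        exact hx'
      have h3 : ∀ k : ℕ, (τ ^ (2 * k)) u = u := by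
        intro k
        induction k with
        | zero => simp
        | succ k ih =>
          have : (τ ^ (2 * (k+1))) u = (τ ^ (2 * k)) (τ (τ u)) := by
            rw [mul_add, pow_add]; rfl
          rw [this, h2, ih]
      have h4 : τ u = u := by
        have h5 : (τ ^ (2 * m + 1)) u = τ u := by
          rw [pow_succ', AlgEquiv.mul_apply, h3]
        rw [← h5, hτ]; rfl
      simpa [sub_eq_zero] using h4
    · rintro ⟨u, hu, rfl⟩
      have hu' : τ u = u := by simpa [sub_eq_zero] using hu
      rw [form1_ker]
      simp only [LinearMap.mulLeft_apply, map_mul, hu']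
      rw [← mul_assoc, hy', mul_assoc]
  rw [this]
  refine ((Submodule.equivMapOfInjective _ ?_ _).finrank_eq).symm
  intro u w h
  exact mul_left_cancel₀ hy0 h

theorem formN_key {K L : Type*} [Field K] [Field L] [Algebra K L] [FiniteDimensional K L]
    [Algebra.IsSeparable K L]
    (σ : L ≃ₐ[K] L) (hσ : ∀ x, σ x = x → ∃ a : K, algebraMap K L a = x) (k : ℕ) (b : ℕ → L)
    (h : 2 * k + 1 ≤ finrank K
      (LinearMap.ker (∑ i ∈ Finset.range k, form1 (σ ^ (i+1)) (b i)))) :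
    ∀ i < k, b i = 0 := by
  let c : ℕ → L := fun j => if j < k then (σ ^ j) (b (k - 1 - j)) else if j = k then 0
    else -(σ ^ k) (b (j - k - 1))
  have hmain := aux_sigma σ hσ (k + 1 + k) c
    (LinearMap.ker (∑ i ∈ Finset.range k, form1 (σ ^ (i+1)) (b i))) (by omega) (by
    intro y hy
    have e : ∑ j ∈ Finset.range (k + 1 + k), c j * (σ ^ j) y
        = ∑ i ∈ Finset.range k, ((σ ^ (k - 1 - i)) (b i) * (σ ^ (k - 1 - i)) y
            - (σ ^ k) (b i) * (σ ^ (k + 1 + i)) y) := by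
      rw [Finset.sum_range_add, Finset.sum_range_succ, Finset.sum_sub_distrib,
        ← Finset.sum_range_reflect, sub_eq_add_neg, ← Finset.sum_neg_distrib]
      have h0 : c k = 0 := by simp [c]
      rw [h0, zero_mul, add_zero]
      congr 1
      · refine Finset.sum_congr rfl fun i hi => ?_
        have hi := Finset.mem_range.1 hi
        have h1 : k - 1 - i < k := by omega
        have h2 : k - 1 - (k - 1 - i) = i := by omega
        simp only [c, h1, if_true, h2]
      · refine Finset.sum_congr rfl fun i hi => ?_
        have h1 : ¬ (k + 1 + i < k) := by omega
        have h2 : ¬ (k + 1 + i = k) := by omega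
        have h3 : k + 1 + i - k - 1 = i := by omega
        simp only [c, h1, h2, if_false, h3, neg_mul]
    rw [e]
    refine aux_nondeg (K := K) _ fun x => ?_
    obtain ⟨x, rfl⟩ := (σ ^ k).surjective x
    have hy' := LinearMap.congr_fun (LinearMap.mem_ker.1 hy) x
    rw [LinearMap.sum_apply, LinearMap.sum_apply, LinearMap.zero_apply] at hy'
    rw [Finset.mul_sum, map_sum, ← hy']
    refine Finset.sum_congr rfl fun i hi => ?_
    have hi := Finset.mem_range.1 hi
    rw [form1_apply, mul_sub (b i), map_sub, ← trace_pow (σ ^ (k - 1 - i)) (b i * (y * _)),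
      ← trace_pow (σ ^ k) (b i * _), ← map_sub]
    congr 1
    have h1 : ∀ z, (σ ^ (k - 1 - i)) ((σ ^ (i + 1)) z) = (σ ^ k) z := by
      intro z
      rw [← AlgEquiv.mul_apply, ← pow_add]; congr 2; omega
    have h2 : ∀ z, (σ ^ k) ((σ ^ (i + 1)) z) = (σ ^ (k + 1 + i)) z := by
      intro z
      rw [← AlgEquiv.mul_apply, ← pow_add]; congr 2; omega
    simp only [map_mul, h1, h2]; ring)
  intro i hi
  have h1 := hmain (k + 1 + i) (by omega)
  have h1' : ¬ (k + 1 + i < k) := by omega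
  have h2 : ¬ (k + 1 + i = k) := by omega
  have h3 : k + 1 + i - k - 1 = i := by omega
  simp only [c, h1', h2, if_false, h3, neg_eq_zero] at h1
  exact (map_eq_zero_iff _ (σ ^ k).injective).1 h1

/-- linear version -/
noncomputable def form1L {K L : Type*} [Field K] [Field L] [Algebra K L] (τ : L ≃ₐ[K] L) :
    L →ₗ[K] LinearMap.BilinForm K L where
  toFun := form1 τ
  map_add' a b := by ext x y; simp [form1_apply, add_mul]
  map_smul' a b := by ext x y; simp [form1_apply]

/-- the parametrization -/
noncomputable def bigPhi {K L : Type*} [Field K] [Field L] [Algebra K L] {n : ℕ}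
    (v : Basis (Fin n) K L) (σ : L ≃ₐ[K] L) (m : ℕ) :
    (Fin m → L) →ₗ[K] Matrix (Fin n) (Fin n) K :=
  LinearMap.lsum K (fun _ => L) K fun i : Fin m =>
    (LinearMap.BilinForm.toMatrix v).toLinearMap.comp (form1L (σ ^ ((i : ℕ) + 1)))

theorem bigPhi_apply {K L : Type*} [Field K] [Field L] [Algebra K L] {n : ℕ}
    (v : Basis (Fin n) K L) (σ : L ≃ₐ[K] L) (m : ℕ) (b : Fin m → L) :
    bigPhi v σ m b = LinearMap.BilinForm.toMatrix v (∑ i : Fin m, form1 (σ ^ ((i : ℕ) + 1)) (b i)) := by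
  simp [bigPhi, form1L]

theorem sum_form1_alt {K L ι : Type*} [Field K] [Field L] [Algebra K L] (s : Finset ι)
    (τ : ι → L ≃ₐ[K] L) (b : ι → L) : LinearMap.BilinForm.IsAlt (∑ i ∈ s, form1 (τ i) (b i)) := by
  intro x
  rw [LinearMap.sum_apply, LinearMap.sum_apply]
  exact Finset.sum_eq_zero fun i _ => form1_alt _ _ x

theorem bigPhi_key {K L : Type*} [Field K] [Field L] [Algebra K L] [FiniteDimensional K L]
    [Algebra.IsSeparable K L] {n : ℕ} (v : Basis (Fin n) K L)
    (σ : L ≃ₐ[K] L) (hσ : ∀ x, σ x = x → ∃ a : K, algebraMap K L a = x) (m k : ℕ) (hkm : k ≤ m)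
    (hn : n = 2 * m + 1)
    (b : Fin m → L) (hb : ∀ i : Fin m, k ≤ (i : ℕ) → b i = 0) (hb0 : b ≠ 0) :
    n - 2 * k + 1 ≤ (bigPhi v σ m b).rank := by
  let b' : ℕ → L := fun i => if h : i < m then b ⟨i, h⟩ else 0
  have hb' : ∀ i : Fin m, b' i = b i := fun i => by simp [b']
  have hsum : ∑ i : Fin m, form1 (σ ^ ((i : ℕ) + 1)) (b i)
      = ∑ i ∈ Finset.range k, form1 (σ ^ (i+1)) (b' i) := by
    have h1 : ∑ i : Fin m, form1 (σ ^ ((i : ℕ) + 1)) (b i)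
      = ∑ i ∈ Finset.range m, form1 (σ ^ (i+1)) (b' i) := by
      rw [Finset.sum_range]
      exact Finset.sum_congr rfl fun i _ => by rw [hb']
    rw [h1]
    symm
    refine Finset.sum_subset (Finset.range_mono hkm) fun i hi hik => ?_
    have hi := Finset.mem_range.1 hi
    have hik : k ≤ i := by simpa using hik
    have : b' i = 0 := by simp only [b', hi, dif_pos]; exact hb ⟨i, hi⟩ hik
    rw [this]
    exact (form1L (σ ^ (i+1))).map_zero
  have hr := aux_rank v (∑ i ∈ Finset.range k, form1 (σ ^ (i+1)) (b' i))
  have hev := aux_alt_even _ (sum_form1_alt (Finset.range k) (fun i => σ ^ (i+1)) b')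
  have hL : finrank K L = n := by simp [finrank_eq_card_basis v]
  rw [bigPhi_apply, hsum]
  by_contra hcon
  rw [hL] at hev
  obtain ⟨t, ht⟩ := hev
  refine hb0 (funext fun i => ?_)
  by_cases hik : k ≤ (i : ℕ)
  · exact hb i hik
  · rw [← hb' i]
    exact formN_key σ hσ k b' (by omega) i (by omega)

theorem bigPhi_inj {K L : Type*} [Field K] [Field L] [Algebra K L] [FiniteDimensional K L]
    [Algebra.IsSeparable K L] {n : ℕ} (v : Basis (Fin n) K L)
    (σ : L ≃ₐ[K] L) (hσ : ∀ x, σ x = x → ∃ a : K, algebraMap K L a = x) (m : ℕ)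
    (hn : n = 2 * m + 1) : Function.Injective (bigPhi v σ m) := by
  rw [← LinearMap.ker_eq_bot, LinearMap.ker_eq_bot']
  intro b hb
  by_contra hb0
  have := bigPhi_key v σ hσ m m le_rfl hn b (fun i hi => absurd i.2 (by omega)) hb0
  rw [hb, Matrix.rank_zero] at this
  omega

theorem alt_finrank_le (K : Type*) [Field K] (n : ℕ) :
    finrank K (altMatrixSubspace K n) ≤ n * (n - 1) / 2 := by
  let f : altMatrixSubspace K n →ₗ[K] ((Σ j : Fin n, Fin (j : ℕ)) → K) :=
    { toFun := fun A p => A.1 ⟨p.2, p.2.2.trans p.1.2⟩ p.1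
      map_add' := fun A B => rfl
      map_smul' := fun a A => rfl }
  have hf : Function.Injective f := by
    rw [← LinearMap.ker_eq_bot, LinearMap.ker_eq_bot']
    rintro ⟨A, hA, hA0⟩ h
    have hlt : ∀ i j : Fin n, i < j → A i j = 0 := fun i j hij =>
      congrFun h ⟨j, ⟨i, hij⟩⟩
    ext i j
    change A i j = 0
    rcases lt_trichotomy i j with h1 | h1 | h1
    · exact hlt i j h1
    · rw [h1]; exact hA0 j
    · have h2 := congrFun (congrFun hA j) i
      rw [Matrix.transpose_apply, Matrix.neg_apply, hlt j i h1, neg_zero] at h2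
      exact h2
  have h := LinearMap.finrank_le_finrank_of_injective hf
  rw [finrank_fintype_fun_eq_card, Fintype.card_sigma] at h
  simp only [Fintype.card_fin] at h
  rwa [← Finset.sum_range (fun i => i), Finset.sum_range_id] at h

theorem bigPhi_mem {K L : Type*} [Field K] [Field L] [Algebra K L] {n : ℕ}
    (v : Basis (Fin n) K L) (σ : L ≃ₐ[K] L) (m : ℕ) (b : Fin m → L) :
    bigPhi v σ m b ∈ altMatrixSubspace K n := by
  have h := sum_form1_alt Finset.univ (fun i : Fin m => σ ^ ((i : ℕ) + 1)) b
  rw [bigPhi_apply]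
  refine ⟨?_, fun i => ?_⟩
  · ext i j
    rw [Matrix.transpose_apply, Matrix.neg_apply, LinearMap.BilinForm.toMatrix_apply,
      LinearMap.BilinForm.toMatrix_apply, LinearMap.BilinForm.IsAlt.neg_eq h]
  · rw [LinearMap.BilinForm.toMatrix_apply]; exact h _


end Aux

open Module in
/-- if `K` admits a cyclic Galois extension `L` of odd degree `n = 2m+1`,
then `Alt_n(K)` decomposes as a direct sum of `m` subspaces `S¹, …, Sᵐ`, each of
dimension `n`, whose nonzero elements have constant rank; moreover for `1 ≤ k ≤ m`
every nonzero element of the `nk`-dimensional subspace `S¹ ⊕ ⋯ ⊕ Sᵏ` has rank at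
least `n − 2k + 1`. -/
theorem statement17 (K : Type*) [Field K] (n m : ℕ) (hnm : n = 2 * m + 1)
    (L : Type*) [Field L] [Algebra K L] [IsGalois K L]
    (hdeg : Module.finrank K L = n) (hcyc : IsCyclic (L ≃ₐ[K] L)) :
    ∃ S : Fin m → Submodule K (Matrix (Fin n) (Fin n) K),
      (∀ i, S i ≤ altMatrixSubspace K n) ∧
      iSupIndep S ∧
      (⨆ i, S i) = altMatrixSubspace K n ∧
      (∀ i, Module.finrank K (S i) = n) ∧
      (∀ i, ∃ r : ℕ, ∀ A ∈ S i, A ≠ 0 → A.rank = r) ∧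
      (∀ k : ℕ, 1 ≤ k → k ≤ m →
        Module.finrank K ↥(⨆ i : Fin m, ⨆ _ : (i : ℕ) < k, S i) = n * k ∧
        ∀ A ∈ (⨆ i : Fin m, ⨆ _ : (i : ℕ) < k, S i), A ≠ 0 →
          n - 2 * k + 1 ≤ A.rank) := by
  have hfr : 0 < finrank K L := by omega
  have : FiniteDimensional K L := FiniteDimensional.of_finrank_pos hfr
  obtain ⟨σ, hσgen⟩ := hcyc.exists_generator
  have hσ : ∀ x, σ x = x → ∃ a : K, algebraMap K L a = x := by
    intro x hx
    refine (IsGalois.mem_range_algebraMap_iff_fixed x).2 fun f => ?_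
    obtain ⟨j, rfl⟩ := Subgroup.mem_zpowers_iff.1 (hσgen f)
    have h1 : σ ∈ MulAction.stabilizer (L ≃ₐ[K] L) x := hx
    exact Subgroup.zpow_mem _ h1 j
  have hσn : σ ^ n = 1 := by
    rw [← hdeg, ← IsGalois.card_aut_eq_finrank]; exact pow_card_eq_one'
  let v : Basis (Fin n) K L := finBasisOfFinrankEq K L hdeg
  have hinj := bigPhi_inj v σ hσ m hnm
  let R : Fin m → Submodule K (Fin m → L) := fun i =>
    LinearMap.range (LinearMap.single K (fun _ : Fin m => L) i)
  have hfin : ∀ W : Submodule K (Fin m → L), finrank K (W.map (bigPhi v σ m)) = finrank K W :=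
    fun W => ((Submodule.equivMapOfInjective _ hinj W).finrank_eq).symm
  have hRind : iSupIndep R := by
    intro i
    have h := LinearMap.disjoint_single_single K (fun _ : Fin m => L) {i} {i}ᶜ
      disjoint_compl_right
    simpa using h
  refine ⟨fun i => (R i).map (bigPhi v σ m), ?_, ?_, ?_, ?_, ?_, ?_⟩
  · rintro i _ ⟨b, -, rfl⟩
    exact bigPhi_mem v σ m b
  · exact LinearMap.iSupIndep_map _ hinj hRind
  · rw [← Submodule.map_iSup]
    have : ⨆ i, R i = ⊤ := LinearMap.iSup_range_single K (fun _ : Fin m => L)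
    rw [this]
    refine Submodule.eq_of_le_of_finrank_le ?_ ?_
    · rintro _ ⟨b, -, rfl⟩
      exact bigPhi_mem v σ m b
    · refine (alt_finrank_le K n).trans ?_
      rw [hfin, finrank_top, Module.finrank_pi_fintype]
      simp only [hdeg, Finset.sum_const, Finset.card_univ, Fintype.card_fin, smul_eq_mul]
      rw [hnm, Nat.add_sub_cancel]
      apply Nat.div_le_of_le_mul
      apply le_of_eq; ring
  · intro i
    rw [hfin, LinearMap.finrank_range_of_inj (by
      simpa using Pi.single_injective (M := fun _ : Fin m => L) i)]
    exact hdeg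
  · intro i
    refine ⟨n - finrank K (LinearMap.ker ((σ ^ ((i : ℕ) + 1)).toLinearMap - LinearMap.id)), ?_⟩
    rintro _ ⟨_, ⟨b, rfl⟩, rfl⟩ hA
    have hb : b ≠ 0 := by rintro rfl; simp at hA
    have hs : ∑ j : Fin m, form1 (σ ^ ((j : ℕ) + 1))
        (LinearMap.single K (fun _ : Fin m => L) i b j) = form1 (σ ^ ((i : ℕ) + 1)) b := by
      rw [Finset.sum_eq_single i]
      · simp
      · intro j _ hj
        simp only [LinearMap.coe_single, Pi.single_eq_of_ne hj]
        exact (form1L _).map_zero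
      · simp
    rw [bigPhi_apply, hs]
    have h1 := aux_rank v (form1 (σ ^ ((i : ℕ) + 1)) b)
    have h2 := form1_rank (σ ^ ((i : ℕ) + 1)) m (hdeg.trans hnm)
      (by rw [← hnm, ← pow_mul, mul_comm, pow_mul, hσn, one_pow]) b hb
    omega
  · intro k _ hkm
    have hI : (⨆ i : Fin m, ⨆ _ : (i : ℕ) < k, R i)
        = ⨅ i ∈ {i : Fin m | (i : ℕ) < k}ᶜ, LinearMap.ker (LinearMap.proj (R := K) (φ := fun _ : Fin m => L) i) :=
      LinearMap.iSup_range_single_eq_iInf_ker_proj K (fun _ : Fin m => L)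
        (I := {i : Fin m | (i : ℕ) < k}) isCompl_compl (Set.toFinite _)
    have hmap : (⨆ i : Fin m, ⨆ _ : (i : ℕ) < k, (R i).map (bigPhi v σ m))
        = (⨆ i : Fin m, ⨆ _ : (i : ℕ) < k, R i).map (bigPhi v σ m) := by
      simp only [Submodule.map_iSup]
    rw [hmap]
    constructor
    · classical
      rw [hfin, hI, (LinearMap.iInfKerProjEquiv K (fun _ : Fin m => L)
        (I := {i : Fin m | (i : ℕ) < k}) disjoint_compl_right (by simp)).finrank_eq,
        Module.finrank_pi_fintype]
      simp only [hdeg, Finset.sum_const, Finset.card_univ, smul_eq_mul]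
      rw [mul_comm]
      congr 1
      rw [Fintype.card_congr (β := Fin k)
        ⟨fun i => ⟨i.1, i.2⟩, fun i => ⟨⟨i, by omega⟩, i.2⟩, fun _ => rfl, fun _ => rfl⟩]
      simp
    · rintro _ ⟨b, hb, rfl⟩ hA
      refine bigPhi_key v σ hσ m k hkm hnm b ?_ (by rintro rfl; simp at hA)
      have hb' : b ∈ ⨆ i : Fin m, ⨆ _ : (i : ℕ) < k, R i := hb
      rw [hI] at hb'
      simp only [Submodule.mem_iInf] at hb'
      intro i hi
      exact hb' i (by simpa using hi)
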